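/- arXiv:1410.6111 — 2 statements merged into one kernel-verified Lean document; each statement's English description precedes it below -/
import Mathlib

section
/- Let X be a finite poset and D ⊆ X an antichain. Then for every n ∈ ℤ there is an isomorphism of abelian groups H^f_n(X, X∖D) ≅ ⊕_{x∈D} H̃^f_{n−1}(Ĉ_x). -/
open scoped Classical

universe u

section ChainComplexes

variable (α : Type u) [PartialOrder α]

/-- The chains of the subposet `S` of `α` (encoded as finsets of `α` contained in `S` that are
totally ordered) having cardinality `n + 1`.  For `n = -1` this contains only the empty chain.
This is the canonical basis of the degree-`n` part of the reduced f-chain complex of `S`. -/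
def RChains (S : Set α) (n : ℤ) : Type u :=
  {s : Finset α // (↑s : Set α) ⊆ S ∧ IsChain (· ≤ ·) (↑s : Set α) ∧ (s.card : ℤ) = n + 1}

/-- The degree-`n` part of the reduced f-chain complex of the subposet `S`:
the free abelian group on the chains of `S` of cardinality `n + 1`
(including the empty chain in degree `-1`). -/
abbrev RCgrp (S : Set α) (n : ℤ) : Type u := RChains α S n →₀ ℤ

/-- The sign `sgn_s(v)`: `(-1) ^ k` where `v` is the `(k+1)`-st smallest element of `s`. -/
noncomputable def chainSgn (s : Finset α) (v : α) : ℤ :=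
  (-1) ^ (s.filter fun a => a < v).card

theorem erase_spec {S : Set α} {n : ℤ} {s : Finset α} (hsub : (↑s : Set α) ⊆ S)
    (hch : IsChain (· ≤ ·) (↑s : Set α)) (hcard : (s.card : ℤ) = n + 1) {v : α} (hv : v ∈ s) :
    (↑(s.erase v) : Set α) ⊆ S ∧ IsChain (· ≤ ·) (↑(s.erase v) : Set α) ∧
      ((s.erase v).card : ℤ) = (n - 1) + 1 := by
  refine ⟨fun x hx => hsub (Finset.coe_subset.mpr (Finset.erase_subset _ _) hx),
    IsChain.mono (Finset.coe_subset.mpr (Finset.erase_subset _ _)) hch, ?_⟩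
  rw [Finset.cast_card_erase_of_mem hv, hcard]; ring

/-- The differential of the reduced f-chain complex of the subposet `S`. -/
noncomputable def rd (S : Set α) (n : ℤ) : RCgrp α S n →+ RCgrp α S (n - 1) :=
  ((Finsupp.lift (RCgrp α S (n - 1)) ℤ (RChains α S n)) (fun s =>
    ∑ v ∈ s.1.attach,
      chainSgn α s.1 v.1 •
        Finsupp.single
          (⟨s.1.erase v.1, erase_spec α s.2.1 s.2.2.1 s.2.2.2 v.2⟩ : RChains α S (n - 1))
          (1 : ℤ))).toAddMonoidHom

/-- The chains of the subposet `S` of cardinality `n + 1` that are not contained in `A`: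
the canonical basis of the degree-`n` part of the relative f-chain complex
`C^f(S, A) = C^f(S)/C^f(A)`. -/
def FChains (S A : Set α) (n : ℤ) : Type u :=
  {s : Finset α // (↑s : Set α) ⊆ S ∧ IsChain (· ≤ ·) (↑s : Set α) ∧ (s.card : ℤ) = n + 1 ∧
      ¬(↑s : Set α) ⊆ A}

/-- The degree-`n` part of the relative f-chain complex `C^f(S, A) = C^f(S)/C^f(A)`,
realized as the free abelian group on the chains of `S` not contained in `A`. -/
abbrev FCgrp (S A : Set α) (n : ℤ) : Type u := FChains α S A n →₀ ℤ

/-- The differential of the relative f-chain complex `C^f(S, A)`. -/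
noncomputable def fd (S A : Set α) (n : ℤ) : FCgrp α S A n →+ FCgrp α S A (n - 1) :=
  ((Finsupp.lift (FCgrp α S A (n - 1)) ℤ (FChains α S A n)) (fun s =>
    ∑ v ∈ s.1.attach,
      chainSgn α s.1 v.1 •
        (if h : ¬(↑(s.1.erase v.1) : Set α) ⊆ A then
          Finsupp.single
            (⟨s.1.erase v.1,
              ⟨(erase_spec α s.2.1 s.2.2.1 s.2.2.2.1 v.2).1,
                (erase_spec α s.2.1 s.2.2.1 s.2.2.2.1 v.2).2.1,
                (erase_spec α s.2.1 s.2.2.1 s.2.2.2.1 v.2).2.2, h⟩⟩ : FChains α S A (n - 1))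
            (1 : ℤ)
         else 0))).toAddMonoidHom

end ChainComplexes

section GradedHomology

/-- Transport along an equality of degrees. -/
def castAddEquiv (G : ℤ → Type*) [∀ n, AddCommGroup (G n)] {m n : ℤ} (h : m = n) :
    G m ≃+ G n := by subst h; exact AddEquiv.refl _

/-- The group of `n`-boundaries of a graded group `G` with degree `-1` maps `d`. -/
noncomputable def boundariesOf (G : ℤ → Type*) [∀ n, AddCommGroup (G n)]
    (d : (n : ℤ) → G n →+ G (n - 1)) (n : ℤ) : AddSubgroup (G n) :=
  AddSubgroup.map (castAddEquiv G (show n + 1 - 1 = n by ring)).toAddMonoidHom (d (n + 1)).range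

/-- The `n`-th homology group of a graded abelian group `G` equipped with degree `-1`
homomorphisms `d` (cycles modulo boundaries; when `d ∘ d = 0` this is the usual homology). -/
noncomputable def gradedHomology (G : ℤ → Type*) [∀ n, AddCommGroup (G n)]
    (d : (n : ℤ) → G n →+ G (n - 1)) (n : ℤ) : Type _ :=
  (d n).ker ⧸ ((boundariesOf G d n).addSubgroupOf (d n).ker)

noncomputable instance (G : ℤ → Type*) [∀ n, AddCommGroup (G n)]
    (d : (n : ℤ) → G n →+ G (n - 1)) (n : ℤ) : AddCommGroup (gradedHomology G d n) :=
  inferInstanceAs (AddCommGroup (_ ⧸ _))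

end GradedHomology

section Homology

variable (α : Type u) [PartialOrder α]

/-- The `n`-th reduced f-homology group `H̃^f_n(S)` of the subposet `S`. -/
noncomputable def RH (S : Set α) (n : ℤ) : Type u :=
  gradedHomology (RCgrp α S) (rd α S) n

noncomputable instance (S : Set α) (n : ℤ) : AddCommGroup (RH α S n) :=
  inferInstanceAs (AddCommGroup (gradedHomology _ _ _))

/-- The `n`-th relative f-homology group `H^f_n(S, A)`. -/
noncomputable def FH (S A : Set α) (n : ℤ) : Type u :=
  gradedHomology (FCgrp α S A) (fd α S A) n

noncomputable instance (S A : Set α) (n : ℤ) : AddCommGroup (FH α S A n) :=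
  inferInstanceAs (AddCommGroup (gradedHomology _ _ _))

/-- The `n`-th (unreduced) f-homology group `H^f_n(S)` of the subposet `S`,
i.e. the homology of the complex freely generated by the nonempty chains of `S`. -/
noncomputable def HF (S : Set α) (n : ℤ) : Type u := FH α S ∅ n

noncomputable instance (S : Set α) (n : ℤ) : AddCommGroup (HF α S n) :=
  inferInstanceAs (AddCommGroup (FH α S ∅ n))

end Homology

theorem castAddEquiv_rfl' (G : ℤ → Type*) [∀ n, AddCommGroup (G n)] {m : ℤ} (h : m = m) (x : G m) :
    castAddEquiv G h x = x := rfl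

theorem mem_bd (G : ℤ → Type*) [∀ n, AddCommGroup (G n)]
    (d : (n : ℤ) → G n →+ G (n - 1)) (n : ℤ) (x : G n) :
    x ∈ boundariesOf G d n ↔ ∃ (m : ℤ) (h : m - 1 = n) (y : G m), castAddEquiv G h (d m y) = x := by
  constructor
  · rintro ⟨_, ⟨y, rfl⟩, rfl⟩
    exact ⟨n + 1, by ring, y, rfl⟩
  · rintro ⟨m, h, y, rfl⟩
    obtain rfl : m = n + 1 := by omega
    exact ⟨_, ⟨y, rfl⟩, rfl⟩

theorem homology_equiv {ι : Type*} (G : ℤ → Type*) [∀ n, AddCommGroup (G n)]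
    (d : (n : ℤ) → G n →+ G (n - 1)) (H : ι → ℤ → Type*) [∀ i n, AddCommGroup (H i n)]
    (δ : ∀ i, (n : ℤ) → H i n →+ H i (n - 1))
    (e : ∀ k, G k ≃+ (∀ i, H i (k - 1)))
    (he : ∀ k g i, δ i (k - 1) (e k g i) = - (e (k - 1) (d k g) i)) (n : ℤ) :
    Nonempty (gradedHomology G d n ≃+ ∀ i, gradedHomology (H i) (δ i) (n - 1)) := by
  have hcast : ∀ (a b : ℤ) (h : a = b) (h' : a - 1 = b - 1) (g : G a) (i : ι),
      castAddEquiv (H i) h' (e a g i) = e b (castAddEquiv G h g) i := by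
    rintro a b rfl h' g i
    rfl
  let ψ : (d n).ker →+ (∀ i, gradedHomology (H i) (δ i) (n - 1)) :=
    { toFun := fun g i => QuotientAddGroup.mk ⟨e n g.1 i, by
        have := he n g.1 i
        rw [AddMonoidHom.mem_ker, this, AddMonoidHom.mem_ker.1 g.2, map_zero]; simp⟩
      map_zero' := by
        funext i
        refine (QuotientAddGroup.eq_zero_iff _).2 ?_
        rw [AddSubgroup.mem_addSubgroupOf]
        simp [zero_mem]
      map_add' := by
        intro a b
        funext i
        refine congrArg QuotientAddGroup.mk ?_
        ext
        simp }
  have hsurj : Function.Surjective ψ := by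
    intro f
    choose z hz using fun i => QuotientAddGroup.mk_surjective (f i)
    have hk : (e n).symm (fun i => (z i).1) ∈ (d n).ker := by
      rw [AddMonoidHom.mem_ker]
      apply (e (n - 1)).injective
      funext i
      have h1 := he n ((e n).symm (fun i => (z i).1)) i
      rw [AddEquiv.apply_symm_apply, AddMonoidHom.mem_ker.1 (z i).2] at h1
      rw [map_zero]
      exact (neg_eq_zero.1 h1.symm)
    refine ⟨⟨_, hk⟩, ?_⟩
    funext i
    rw [← hz i]
    refine congrArg QuotientAddGroup.mk ?_
    ext
    simp
  have hker : ψ.ker = (boundariesOf G d n).addSubgroupOf (d n).ker := by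
    ext g
    rw [AddMonoidHom.mem_ker, AddSubgroup.mem_addSubgroupOf, mem_bd]
    have h0 : ψ g = 0 ↔ ∀ i, e n g.1 i ∈ boundariesOf (H i) (δ i) (n - 1) := by
      rw [funext_iff]
      refine forall_congr' fun i => ?_
      refine (QuotientAddGroup.eq_zero_iff _).trans ?_
      rw [AddSubgroup.mem_addSubgroupOf]
    rw [h0]
    constructor
    · intro h
      have h2 : ∀ i, ∃ y : H i (n + 1 - 1),
          castAddEquiv (H i) (show n + 1 - 1 - 1 = n - 1 by ring) (δ i (n + 1 - 1) y) = e n g.1 i := by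
        intro i
        obtain ⟨m, hm, y, hy⟩ := (mem_bd _ _ _ _).1 (h i)
        obtain rfl : m = n + 1 - 1 := by omega
        exact ⟨y, hy⟩
      choose y hy using h2
      refine ⟨n + 1, by ring, - (e (n + 1)).symm y, ?_⟩
      apply (e n).injective
      funext i
      rw [← hcast (n + 1 - 1) n (by ring) (by ring), ← hy i, map_neg, map_neg, Pi.neg_apply, ← he,
        AddEquiv.apply_symm_apply]
    · rintro ⟨m, h, y, hy⟩ i
      rw [mem_bd]
      refine ⟨m - 1, by omega, - e m y i, ?_⟩
      rw [← hy, map_neg, he, neg_neg, hcast _ _ h]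
  exact ⟨(QuotientAddGroup.quotientAddEquivOfEq hker.symm).trans
    (QuotientAddGroup.quotientKerEquivOfSurjective ψ hsurj)⟩

section Main
variable {α : Type u} [PartialOrder α]

theorem rd_single (S : Set α) (n : ℤ) (s : RChains α S n) (t : RChains α S (n - 1)) :
    rd α S n (Finsupp.single s 1) t =
      ∑ v ∈ s.1, chainSgn α s.1 v * (if s.1.erase v = t.1 then 1 else 0) := by
  rw [← Finset.sum_attach]
  simp only [rd, LinearMap.toAddMonoidHom_coe, Finsupp.lift_apply]
  rw [Finsupp.sum_single_index (by simp), one_smul]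
  refine (Finsupp.finsetSum_apply _ _ _).trans ?_
  refine Finset.sum_congr rfl fun v _ => ?_
  refine (Finsupp.smul_apply _ _ _).trans ?_
  refine congrArg (fun z : ℤ => chainSgn α s.1 v.1 * z) ?_
  refine Finsupp.single_apply.trans (if_congr ?_ rfl rfl)
  exact Subtype.ext_iff

theorem fd_single (S A : Set α) (n : ℤ) (s : FChains α S A n) (t : FChains α S A (n - 1)) :
    fd α S A n (Finsupp.single s 1) t =
      ∑ v ∈ s.1, chainSgn α s.1 v * (if s.1.erase v = t.1 then 1 else 0) := by
  rw [← Finset.sum_attach]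
  simp only [fd, LinearMap.toAddMonoidHom_coe, Finsupp.lift_apply]
  rw [Finsupp.sum_single_index (by simp), one_smul]
  refine (Finsupp.finsetSum_apply _ _ _).trans ?_
  refine Finset.sum_congr rfl fun v _ => ?_
  refine (Finsupp.smul_apply _ _ _).trans ?_
  refine congrArg (fun z : ℤ => chainSgn α s.1 v.1 * z) ?_
  split_ifs with h1 h2 h2
  · exact absurd h1 (h2 ▸ t.2.2.2.2)
  · rfl
  · refine Finsupp.single_apply.trans (if_pos ?_)
    exact Subtype.ext h2
  · refine Finsupp.single_apply.trans (if_neg ?_)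
    exact fun h => h2 (congrArg Subtype.val h)

/-- The link of `x`. -/
abbrev lk (x : α) : Set α := {a | a ≤ x ∨ x ≤ a} \ {x}

theorem notMem_lk {x : α} {n : ℤ} (t : RChains α (lk x) n) : x ∉ t.1 :=
  fun h => (t.2.1 h).2 rfl

noncomputable def insC (D : Set α) (x : D) (n : ℤ) (t : RChains α (lk (x : α)) (n - 1)) :
    FChains α Set.univ Dᶜ n :=
  ⟨insert (x : α) t.1, Set.subset_univ _, by
    rw [Finset.coe_insert]
    refine t.2.2.1.insert fun b hb _ => ?_
    rcases (t.2.1 hb).1 with h | h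
    · exact Or.inr h
    · exact Or.inl h, by
    rw [Finset.card_insert_of_notMem (notMem_lk t)]
    have := t.2.2.2
    push_cast; omega,
    fun h => h (Finset.mem_coe.2 (Finset.mem_insert_self _ _)) x.2⟩

noncomputable def delC (D : Set α) (x : D) (n : ℤ) (s : FChains α Set.univ Dᶜ n) (hx : (x : α) ∈ s.1) :
    RChains α (lk (x : α)) (n - 1) :=
  ⟨s.1.erase x, by
    intro a ha
    rw [Finset.mem_coe, Finset.mem_erase] at ha
    exact ⟨s.2.2.1.total ha.2 hx, ha.1⟩,
    (erase_spec α s.2.1 s.2.2.1 s.2.2.2.1 hx).2⟩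

theorem insC_delC (D : Set α) (x : D) (n : ℤ) (s : FChains α Set.univ Dᶜ n) (hx : (x : α) ∈ s.1) :
    insC D x n (delC D x n s hx) = s := Subtype.ext (Finset.insert_erase hx)

theorem delC_insC (D : Set α) (x : D) (n : ℤ) (t : RChains α (lk (x : α)) (n - 1)) (h) :
    delC D x n (insC D x n t) h = t := Subtype.ext (Finset.erase_insert (notMem_lk t))

theorem sgn_sq (s : Finset α) (v : α) : chainSgn α s v * chainSgn α s v = 1 := by
  rw [chainSgn, ← mul_pow]; simp

theorem uniq {D : Set α} (hD : IsAntichain (· ≤ ·) D) {n : ℤ} (s : FChains α Set.univ Dᶜ n)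
    {x y : D} (hx : (x : α) ∈ s.1) (hy : (y : α) ∈ s.1) : x = y := by
  apply Subtype.ext
  rcases s.2.2.1.total hx hy with h | h
  · exact hD.eq x.2 y.2 h
  · exact (hD.eq y.2 x.2 h).symm

theorem exists_mem {D : Set α} {n : ℤ} (s : FChains α Set.univ Dᶜ n) :
    ∃ x : D, (x : α) ∈ s.1 := by
  obtain ⟨a, h1, h2⟩ := Set.not_subset.1 s.2.2.2.2
  exact ⟨⟨a, not_not.1 h2⟩, h1⟩

instance [Finite α] (S : Set α) (n : ℤ) : Finite (RChains α S n) :=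
  inferInstanceAs (Finite (Subtype _))

instance [Finite α] (S A : Set α) (n : ℤ) : Finite (FChains α S A n) :=
  inferInstanceAs (Finite (Subtype _))

noncomputable def eC [Fintype α] (D : Set α) (hD : IsAntichain (· ≤ ·) D) (n : ℤ) :
    FCgrp α Set.univ Dᶜ n ≃+ ∀ x : D, RCgrp α (lk (x : α)) (n - 1) where
  toFun g x := Finsupp.equivFunOnFinite.symm fun t =>
    chainSgn α (insC D x n t).1 x * g (insC D x n t)
  invFun f := Finsupp.equivFunOnFinite.symm fun s =>
    ∑ x : D, if h : (x : α) ∈ s.1 then chainSgn α s.1 x * f x (delC D x n s h) else 0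
  left_inv g := by
    ext s
    obtain ⟨x, hx⟩ := exists_mem s
    simp only [Finsupp.coe_equivFunOnFinite_symm]
    rw [Finset.sum_eq_single x]
    · rw [dif_pos hx, insC_delC, ← mul_assoc, sgn_sq, one_mul]
    · intro y _ hy
      exact dif_neg fun h => hy (uniq hD s h hx)
    · simp
  right_inv f := by
    funext x
    ext t
    have hx : (x : α) ∈ (insC D x n t).1 := Finset.mem_insert_self _ _
    simp only [Finsupp.coe_equivFunOnFinite_symm]
    rw [Finset.sum_eq_single x]
    · rw [dif_pos hx, delC_insC, ← mul_assoc, sgn_sq, one_mul]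
    · intro y _ hy
      exact dif_neg fun h => hy (uniq hD _ h hx)
    · simp
  map_add' g h := by
    funext x
    ext t
    simp [mul_add]

theorem eC_apply [Fintype α] (D : Set α) (hD : IsAntichain (· ≤ ·) D) (n : ℤ) (g x t) :
    eC D hD n g x t = chainSgn α (insC D x n t).1 x * g (insC D x n t) := rfl

theorem eC_single_pos [Fintype α] (D : Set α) (hD : IsAntichain (· ≤ ·) D) (n : ℤ) (s) (x : D)
    (hx : (x : α) ∈ s.1) :
    eC D hD n (Finsupp.single s 1) x
      = chainSgn α s.1 x • Finsupp.single (delC D x n s hx) (1 : ℤ) := by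
  ext t
  rw [eC_apply, Finsupp.smul_apply, smul_eq_mul, Finsupp.single_apply, Finsupp.single_apply]
  by_cases h : s = insC D x n t
  · subst h
    rw [if_pos rfl, if_pos (delC_insC _ _ _ _ _)]
  · rw [if_neg h, if_neg, mul_zero, mul_zero]
    intro h'
    apply h
    rw [← h', insC_delC]

theorem eC_single_neg [Fintype α] (D : Set α) (hD : IsAntichain (· ≤ ·) D) (n : ℤ) (s) (x : D)
    (hx : (x : α) ∉ s.1) :
    eC D hD n (Finsupp.single s 1) x = 0 := by
  ext t
  rw [eC_apply, Finsupp.single_apply, if_neg, mul_zero]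
  · rfl
  · rintro rfl
    exact hx (Finset.mem_insert_self _ _)

theorem sgn_erase (s : Finset α) {v x : α} (hv : v ∈ s) :
    chainSgn α s x = (if v < x then -1 else 1) * chainSgn α (s.erase v) x := by
  unfold chainSgn
  rw [Finset.filter_erase]
  split_ifs with h
  · rw [← Finset.card_erase_add_one (show v ∈ s.filter (· < x) by simp [hv, h]), pow_succ]
    ring
  · rw [Finset.erase_eq_of_notMem (by simp [h]), one_mul]

theorem sgn_comm {s : Finset α} (hs : IsChain (· ≤ ·) (s : Set α)) {v x : α} (hv : v ∈ s)
    (hx : x ∈ s) (hvx : v ≠ x) :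
    chainSgn α s x * chainSgn α (s.erase x) v = -(chainSgn α (s.erase v) x * chainSgn α s v) := by
  rw [sgn_erase s (x := x) hv, sgn_erase s (x := v) hx]
  rcases hs.total hv hx with h | h
  · have h1 : v < x := lt_of_le_of_ne h hvx
    rw [if_pos h1, if_neg h1.asymm]; ring
  · have h1 : x < v := lt_of_le_of_ne h hvx.symm
    rw [if_pos h1, if_neg h1.asymm]; ring

theorem eC_comm [Fintype α] (D : Set α) (hD : IsAntichain (· ≤ ·) D) (k : ℤ) (g) (x : D) :
    rd α (lk (x : α)) (k - 1) (eC D hD k g x) = -(eC D hD (k - 1) (fd α Set.univ Dᶜ k g) x) := by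
  let L : FCgrp α Set.univ Dᶜ k →+ RCgrp α (lk (x : α)) (k - 1 - 1) :=
    (rd α (lk (x : α)) (k - 1)).comp ((Pi.evalAddMonoidHom _ x).comp (eC D hD k).toAddMonoidHom)
  let R : FCgrp α Set.univ Dᶜ k →+ RCgrp α (lk (x : α)) (k - 1 - 1) :=
    -((Pi.evalAddMonoidHom _ x).comp
      ((eC D hD (k - 1)).toAddMonoidHom.comp (fd α Set.univ Dᶜ k)))
  suffices h : L = R from DFunLike.congr_fun h g
  refine Finsupp.addHom_ext' fun s => AddMonoidHom.ext_int ?_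
  change rd α (lk (x : α)) (k - 1) (eC D hD k (Finsupp.single s 1) x) =
    -(eC D hD (k - 1) (fd α Set.univ Dᶜ k (Finsupp.single s 1)) x)
  ext t
  have hxt := notMem_lk t
  rw [Finsupp.neg_apply, eC_apply, fd_single]
  have hi : (insC D x (k - 1) t).1 = insert (x : α) t.1 := rfl
  rw [hi]
  by_cases hx : (x : α) ∈ s.1
  · rw [eC_single_pos _ _ _ _ _ hx, map_zsmul, Finsupp.smul_apply, smul_eq_mul, rd_single]
    have hd : (delC D x k s hx).1 = s.1.erase x := rfl
    rw [hd, ← Finset.add_sum_erase s.1 _ hx, if_neg, mul_zero, zero_add, Finset.mul_sum,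
      Finset.mul_sum, ← Finset.sum_neg_distrib]
    · refine Finset.sum_congr rfl fun v hv => ?_
      rw [Finset.mem_erase] at hv
      by_cases h : s.1.erase v = insert (x : α) t.1
      · have h' : (s.1.erase x).erase v = t.1 := by
          rw [Finset.erase_right_comm, h, Finset.erase_insert hxt]
        rw [if_pos h, if_pos h', ← h, mul_one, mul_one]
        exact sgn_comm s.2.2.1 hv.2 hx hv.1
      · rw [if_neg h, if_neg]
        · simp
        · intro h'
          apply h
          rw [← h', Finset.erase_right_comm, Finset.insert_erase]
          exact Finset.mem_erase.2 ⟨hv.1.symm, hx⟩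
    · intro h
      have := Finset.mem_insert_self (x : α) t.1
      rw [← h] at this
      simp at this
  · rw [eC_single_neg _ _ _ _ _ hx, map_zero, Finset.sum_eq_zero]
    · simp
    · intro v _
      rw [if_neg, mul_zero]
      intro h
      have := Finset.mem_insert_self (x : α) t.1
      rw [← h] at this
      exact hx (Finset.mem_of_mem_erase this)

end Main

/-- For a finite poset `X` and an antichain `D ⊆ X`, for every `n ∈ ℤ` there is an
isomorphism `H^f_n(X, X∖D) ≅ ⊕_{x ∈ D} H̃^f_{n-1}(Ĉ_x)`, where
`Ĉ_x = {a | a ≤ x ∨ x ≤ a} ∖ {x}`. -/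
theorem stmt2 {α : Type u} [PartialOrder α] [Fintype α] (D : Set α)
    (hD : IsAntichain (· ≤ ·) D) (n : ℤ) :
    Nonempty (FH α Set.univ Dᶜ n ≃+
      Π₀ x : D, RH α ({a | a ≤ (x : α) ∨ (x : α) ≤ a} \ {(x : α)}) (n - 1)) := by
  obtain ⟨E⟩ := homology_equiv (FCgrp α Set.univ Dᶜ) (fd α Set.univ Dᶜ)
    (fun x : D => RCgrp α (lk (x : α))) (fun x : D => rd α (lk (x : α))) (eC D hD)
    (fun k g x => eC_comm D hD k g x) n
  let F : (Π₀ x : D, RH α (lk (x : α)) (n - 1)) ≃+ (∀ x : D, RH α (lk (x : α)) (n - 1)) :=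
    { DFinsupp.equivFunOnFintype with
      map_add' := fun a b => rfl }
  exact ⟨AddEquiv.trans E F.symm⟩
end

section
/- Let X be a finite poset which is quasicellular with quasicellular morphism ρ. Then there exists a chain complex (C_n, d_n) of abelian groups with C_n = ⊕_{x : ρ(x)=n} H̃^f_{n−1}(Û_x) for n ≥ 0 (and C_n = 0 for n < 0), whose differentials satisfy: for every x with ρ(x) = n, every cycle Σ_i a_i s_i of degree n−1 of the reduced f-chain complex of Û_x (each s_i an (n−1)-chain of Û_x), and every y with ρ(y) = n−1, the y-component of d_n applied to the class [Σ_i a_i s_i], placed in the x-summand, equals the class of Σ_{i : y ∈ s_i} a_i · sgn_{s_i}(y) · (s_i ∖ {y}) in H̃^f_{n−2}(Û_y); and such that H_n of this chain complex is isomorphic to H^f_n(X) for all n ∈ ℤ. -/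
open scoped Classical

universe u

section Extras

variable (α : Type u) [PartialOrder α]

/-- The inclusion of chain complexes induced by an inclusion of subposets `S ⊆ T`. -/
noncomputable def RCmap {S T : Set α} (h : S ⊆ T) (n : ℤ) : RCgrp α S n →+ RCgrp α T n :=
  Finsupp.mapDomain.addMonoidHom
    (fun s : RChains α S n => (⟨s.1, s.2.1.trans h, s.2.2.1, s.2.2.2⟩ : RChains α T n))

/-- `removePt α S y n` is the homomorphism sending a chain `s` of `S` of dimension `n` to
`sgn_s(y) • (s ∖ {y})` when `y ∈ s` and to `0` otherwise, the result being regarded as a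
chain of the ambient poset.  Hence it sends `∑ aᵢ • sᵢ` to
`∑_{sᵢ ∋ y} aᵢ • sgn_{sᵢ}(y) • (sᵢ ∖ {y})`. -/
noncomputable def removePt (S : Set α) (y : α) (n : ℤ) :
    RCgrp α S n →+ RCgrp α Set.univ (n - 1) :=
  ((Finsupp.lift (RCgrp α Set.univ (n - 1)) ℤ (RChains α S n)) (fun s =>
    if h : y ∈ s.1 then
      chainSgn α s.1 y •
        Finsupp.single
          (⟨s.1.erase y,
            erase_spec α (Set.subset_univ _) s.2.2.1 s.2.2.2 h⟩ : RChains α Set.univ (n - 1))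
          (1 : ℤ)
    else 0)).toAddMonoidHom

/-- The projection `C^f(S) → C^f(S, A) = C^f(S)/C^f(A)` (killing the chains contained
in `A`). -/
noncomputable def projMap (S A : Set α) (n : ℤ) : RCgrp α S n →+ FCgrp α S A n :=
  ((Finsupp.lift (FCgrp α S A n) ℤ (RChains α S n)) (fun s =>
    if h : ¬(↑s.1 : Set α) ⊆ A then
      Finsupp.single (⟨s.1, s.2.1, s.2.2.1, s.2.2.2, h⟩ : FChains α S A n) (1 : ℤ)
    else 0)).toAddMonoidHom

/-- The homology class of a cycle of the reduced f-chain complex. -/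
noncomputable def RH.mk {S : Set α} {n : ℤ} (σ : RCgrp α S n) (hσ : σ ∈ (rd α S n).ker) :
    RH α S n :=
  QuotientAddGroup.mk (⟨σ, hσ⟩ : (rd α S n).ker)

/-- The homology class of a cycle of the relative f-chain complex. -/
noncomputable def FH.mk {S A : Set α} {n : ℤ} (σ : FCgrp α S A n)
    (hσ : σ ∈ (fd α S A n).ker) : FH α S A n :=
  QuotientAddGroup.mk (⟨σ, hσ⟩ : (fd α S A n).ker)

end Extras

/-- `ρ` is a quasicellular morphism for the poset `α`: it is order preserving, its level sets
are antichains, and for every `x` the reduced f-homology of `Û_x = {a | a < x}` is zero in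
every degree other than `ρ(x) - 1` and nonzero in degree `ρ(x) - 1`. -/
def IsQuasicellular (α : Type u) [PartialOrder α] (ρ : α → ℕ) : Prop :=
  Monotone ρ ∧ (∀ n : ℕ, IsAntichain (· ≤ ·) {x : α | ρ x = n}) ∧
    ∀ x : α,
      (∀ k : ℤ, k ≠ (ρ x : ℤ) - 1 → Subsingleton (RH α {a | a < x} k)) ∧
        ¬Subsingleton (RH α {a | a < x} ((ρ x : ℤ) - 1))


set_option linter.unusedSectionVars false

section Aux

variable {α : Type u} [PartialOrder α]

abbrev FF (α : Type u) := Finset α →₀ ℤ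

noncomputable def Rm (y : α) : FF α →ₗ[ℤ] FF α :=
  Finsupp.lift (FF α) ℤ (Finset α)
    (fun s => if y ∈ s then chainSgn α s y • Finsupp.single (s.erase y) (1 : ℤ) else 0)

noncomputable def Kx (x : α) : FF α →ₗ[ℤ] FF α :=
  Finsupp.lift (FF α) ℤ (Finset α)
    (fun s => ((-1 : ℤ) ^ s.card) • Finsupp.single (insert x s) (1 : ℤ))

noncomputable def DD [Fintype α] : FF α →ₗ[ℤ] FF α := ∑ y, Rm y

theorem Rm_single (y : α) (s : Finset α) : Rm y (Finsupp.single s (1 : ℤ)) =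
    if y ∈ s then chainSgn α s y • Finsupp.single (s.erase y) (1 : ℤ) else 0 := by
  simp only [Rm, Finsupp.lift_apply, Finsupp.sum_single_index, zero_smul, one_smul]

theorem Kx_single (y : α) (s : Finset α) : Kx y (Finsupp.single s (1 : ℤ)) =
    ((-1 : ℤ) ^ s.card) • Finsupp.single (insert y s) (1 : ℤ) := by
  simp only [Kx, Finsupp.lift_apply, Finsupp.sum_single_index, zero_smul, one_smul]

def ChP (S : Set α) (n : ℤ) : Set (Finset α) :=
  {s | (↑s : Set α) ⊆ S ∧ IsChain (· ≤ ·) (↑s : Set α) ∧ (s.card : ℤ) = n + 1}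

abbrev Ch (S : Set α) (n : ℤ) : Submodule ℤ (FF α) := Finsupp.supported ℤ ℤ (ChP S n)

theorem supp_eq {M : Type*} [AddCommGroup M] {P : Set (Finset α)} {A B : FF α →ₗ[ℤ] M}
    (h : ∀ s ∈ P, A (Finsupp.single s 1) = B (Finsupp.single s 1)) {f : FF α}
    (hf : f ∈ Finsupp.supported ℤ ℤ P) : A f = B f := by
  rw [Finsupp.supported_eq_span_single] at hf
  refine LinearMap.eqOn_span (s := (fun i => Finsupp.single i (1:ℤ)) '' P) ?_ hf
  rintro _ ⟨s, hs, rfl⟩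
  exact h s hs

theorem supp_mem {M : Type*} [AddCommGroup M] {P : Set (Finset α)} {A : FF α →ₗ[ℤ] M}
    {W : Submodule ℤ M}
    (h : ∀ s ∈ P, A (Finsupp.single s 1) ∈ W) {f : FF α}
    (hf : f ∈ Finsupp.supported ℤ ℤ P) : A f ∈ W := by
  rw [Finsupp.supported_eq_span_single] at hf
  have : Submodule.span ℤ ((fun i => Finsupp.single i (1:ℤ)) '' P) ≤ W.comap A := by
    rw [Submodule.span_le]
    rintro _ ⟨s, hs, rfl⟩
    exact h s hs
  exact this hf

theorem single_mem {P : Set (Finset α)} {s : Finset α} (hs : s ∈ P) :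
    Finsupp.single s (1 : ℤ) ∈ Finsupp.supported ℤ ℤ P :=
  Finsupp.single_mem_supported ℤ _ hs

theorem Rm_mem {S : Set α} {n : ℤ} {f : FF α} (hf : f ∈ Ch S n) (y : α) :
    Rm y f ∈ Ch S (n - 1) := by
  refine supp_mem (fun s hs => ?_) hf
  rw [Rm_single]
  split_ifs with h
  · exact Submodule.smul_mem _ _ (single_mem (erase_spec α hs.1 hs.2.1 hs.2.2 h))
  · exact Submodule.zero_mem _

theorem sgn_erase_lt {s : Finset α} {v w : α} (hv : v ∈ s) (h : v < w) :
    chainSgn α (s.erase v) w = - chainSgn α s w := by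
  unfold chainSgn
  have h1 : (s.erase v).filter (fun a => a < w) = (s.filter (fun a => a < w)).erase v := by
    ext a; simp; tauto
  have h2 : v ∈ s.filter (fun a => a < w) := by simp [hv, h]
  rw [h1, ← Finset.card_erase_add_one h2, pow_succ]; ring

theorem sgn_erase_not_lt {s : Finset α} {v w : α} (h : ¬ v < w) :
    chainSgn α (s.erase v) w = chainSgn α s w := by
  unfold chainSgn
  have h1 : (s.erase v).filter (fun a => a < w) = s.filter (fun a => a < w) := by
    ext a; simp only [Finset.mem_filter, Finset.mem_erase]
    constructor
    · tauto
    · rintro ⟨h1, h2⟩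
      exact ⟨⟨fun e => h (e ▸ h2), h1⟩, h2⟩
  rw [h1]

theorem Rm_anti {f : FF α} {S : Set α} {n : ℤ} (hf : f ∈ Ch S n) (v w : α) :
    Rm v (Rm w f) = - Rm w (Rm v f) := by
  refine supp_eq (A := Rm v ∘ₗ Rm w) (B := - (Rm w ∘ₗ Rm v)) (fun s hs => ?_) hf
  simp only [LinearMap.comp_apply, LinearMap.neg_apply, Rm_single]
  by_cases hvw : v = w
  · subst hvw
    split_ifs <;> simp [Rm_single, -zsmul_eq_mul, -Finsupp.smul_single]
  by_cases hv : v ∈ s <;> by_cases hw : w ∈ s <;>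
    simp [hv, hw, Rm_single, hvw, Ne.symm hvw, -zsmul_eq_mul, -Finsupp.smul_single]
  rw [Finset.erase_right_comm, ← neg_smul, smul_smul, smul_smul]
  congr 1
  rcases hs.2.1 hv hw hvw with h | h
  · have h := lt_of_le_of_ne h hvw
    rw [sgn_erase_lt hv h, sgn_erase_not_lt (not_lt_of_gt h)]; ring
  · have h := lt_of_le_of_ne h (Ne.symm hvw)
    rw [sgn_erase_lt hw h, sgn_erase_not_lt (not_lt_of_gt h)]; ring

variable [Fintype α]

theorem DD_apply (f : FF α) : DD f = ∑ y, Rm y f := by simp [DD]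

theorem DD_mem {S : Set α} {n : ℤ} {f : FF α} (hf : f ∈ Ch S n) : DD f ∈ Ch S (n - 1) := by
  rw [DD_apply]
  exact Submodule.sum_mem _ fun y _ => Rm_mem hf y

theorem Rm_DD {f : FF α} {S : Set α} {n : ℤ} (hf : f ∈ Ch S n) (v : α) :
    Rm v (DD f) = - DD (Rm v f) := by
  rw [DD_apply, DD_apply, map_sum, ← Finset.sum_neg_distrib]
  exact Finset.sum_congr rfl fun w _ => Rm_anti hf v w

theorem DD_DD {f : FF α} {S : Set α} {n : ℤ} (hf : f ∈ Ch S n) : DD (DD f) = 0 := by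
  have h : DD (DD f) = - DD (DD f) := by
    conv_lhs => rw [DD_apply (DD f)]
    simp_rw [Rm_DD hf]
    rw [Finset.sum_neg_distrib, DD_apply f, map_sum]
  exact self_eq_neg.mp h

theorem Rm_Kx_ne {x v : α} (hvx : v ≠ x) {n : ℤ} {f : FF α} (hf : f ∈ Ch {a | a < x} n) :
    Rm v (Kx x f) = - Kx x (Rm v f) := by
  refine supp_eq (A := Rm v ∘ₗ Kx x) (B := - (Kx x ∘ₗ Rm v)) (fun s hs => ?_) hf
  simp only [LinearMap.comp_apply, LinearMap.neg_apply, Rm_single, Kx_single, map_smul]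
  by_cases hv : v ∈ s
  · have hvx' : v < x := hs.1 hv
    simp only [Finset.mem_insert, hv, or_true, if_true, map_smul, Kx_single]
    have h1 : (insert x s).erase v = insert x (s.erase v) := by
      rw [Finset.erase_insert_of_ne (Ne.symm hvx)]
    have hxs : x ∉ s := fun h => lt_irrefl x (hs.1 h)
    have h2 : chainSgn α (insert x s) v = chainSgn α s v := by
      have := sgn_erase_not_lt (s := insert x s) (not_lt_of_gt hvx')
      rw [Finset.erase_insert hxs] at this
      exact this.symm
    rw [h1, h2, ← Finset.card_erase_add_one hv, pow_succ, smul_smul, smul_smul, ← neg_smul]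
    congr 1; ring
  · simp [hv, hvx]

theorem Rm_of_notMem {x : α} {S : Set α} (hx : x ∉ S) {n : ℤ} {f : FF α} (hf : f ∈ Ch S n) :
    Rm x f = 0 := by
  refine supp_eq (B := 0) (fun s hs => ?_) hf
  rw [Rm_single, if_neg (fun h : x ∈ s => hx (hs.1 h))]; rfl

theorem Rm_Kx_self {x : α} {n : ℤ} {f : FF α} (hf : f ∈ Ch {a | a < x} n) :
    Rm x (Kx x f) = f := by
  refine supp_eq (A := Rm x ∘ₗ Kx x) (B := LinearMap.id) (fun s hs => ?_) hf
  simp only [LinearMap.comp_apply, Rm_single, Kx_single, map_smul, LinearMap.id_apply]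
  have hxs : x ∉ s := fun h => lt_irrefl x (hs.1 h)
  have h2 : chainSgn α (insert x s) x = (-1) ^ s.card := by
    unfold chainSgn
    congr 2
    ext a
    simp only [Finset.mem_filter, Finset.mem_insert]
    constructor
    · rintro ⟨h | h, h'⟩
      · exact absurd h'.ne (by simp [h])
      · exact h
    · intro h; exact ⟨Or.inr h, hs.1 h⟩
  rw [if_pos (Finset.mem_insert_self _ _), Finset.erase_insert hxs, h2, smul_smul, ← mul_pow]
  simp

theorem Kx_mem {x : α} {n : ℤ} {f : FF α} (hf : f ∈ Ch {a | a < x} n) {T : Set α}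
    (hT : {a | a < x} ⊆ T) (hx : x ∈ T) :
    Kx x f ∈ Ch T (n + 1) := by
  refine supp_mem (fun s hs => ?_) hf
  rw [Kx_single]
  have hxs : x ∉ s := fun h => lt_irrefl x (hs.1 h)
  refine Submodule.smul_mem _ _ (single_mem ⟨?_, ?_, ?_⟩)
  · rw [Finset.coe_insert]
    exact Set.insert_subset hx (hs.1.trans hT)
  · rw [Finset.coe_insert]
    exact hs.2.1.insert fun b hb _ => Or.inr (le_of_lt (hs.1 hb))
  · rw [Finset.card_insert_of_notMem hxs]; push_cast; rw [hs.2.2]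

theorem DD_Kx {x : α} {n : ℤ} {f : FF α} (hf : f ∈ Ch {a | a < x} n) :
    DD (Kx x f) = f - Kx x (DD f) := by
  rw [DD_apply, DD_apply, map_sum, ← Finset.add_sum_erase _ _ (Finset.mem_univ x),
    ← Finset.add_sum_erase _ (fun y => Kx x (Rm y f)) (Finset.mem_univ x), Rm_Kx_self hf,
    Rm_of_notMem (by simp) hf, map_zero, zero_add, sub_eq_add_neg, ← Finset.sum_neg_distrib]
  congr 1
  exact Finset.sum_congr rfl fun v hv => Rm_Kx_ne (Finset.ne_of_mem_erase hv) hf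

/-- levels -/
def cX (ρ : α → ℕ) (M : ℤ) : Set α := {a | (ρ a : ℤ) ≤ M}

abbrev SX (ρ : α → ℕ) (M : ℤ) : Submodule ℤ (FF α) :=
  Finsupp.supported ℤ ℤ {s | (↑s : Set α) ⊆ cX ρ M}

theorem Ch_mono {S T : Set α} (h : S ⊆ T) (n : ℤ) : Ch S n ≤ Ch T n :=
  Finsupp.supported_mono fun _ hs => ⟨hs.1.trans h, hs.2⟩

theorem cX_mono (ρ : α → ℕ) {M N : ℤ} (h : M ≤ N) : cX ρ M ⊆ cX ρ N :=
  fun _ ha => le_trans (Set.mem_ofPred.mp ha) h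

theorem Ch_le_SX {ρ : α → ℕ} {M n : ℤ} : Ch (cX ρ M) n ≤ SX ρ M :=
  Finsupp.supported_mono fun _ hs => hs.1

theorem SX_mono (ρ : α → ℕ) {M N : ℤ} (h : M ≤ N) : SX ρ M ≤ SX ρ N :=
  Finsupp.supported_mono fun _ hs => Set.Subset.trans hs (cX_mono ρ h)

theorem Ch_of_SX {ρ : α → ℕ} {M n : ℤ} {S : Set α} {f : FF α} (hf : f ∈ Ch S n)
    (h : f ∈ SX ρ M) : f ∈ Ch (cX ρ M) n := by
  rw [Finsupp.mem_supported] at *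
  exact fun s hs => ⟨h hs, (hf hs).2⟩

theorem Rm_SX {ρ : α → ℕ} {M : ℤ} {x : α} (hx : M < ρ x) {f : FF α} (hf : f ∈ SX ρ M) :
    Rm x f = 0 := by
  refine supp_eq (B := 0) (fun s hs => ?_) hf
  rw [Rm_single, if_neg (fun h : x ∈ s => absurd (show (ρ x : ℤ) ≤ M from hs h) (by omega))]
  rfl

theorem lt_sub {ρ : α → ℕ} (hs : StrictMono ρ) {x : α} {M : ℤ} (hx : (ρ x : ℤ) ≤ M + 1) :
    {a | a < x} ⊆ cX ρ M := fun a ha => by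
  have := hs (Set.mem_ofPred.mp ha)
  show (ρ a : ℤ) ≤ M
  omega

theorem top_lt {ρ : α → ℕ} (hρ : StrictMono ρ) {M n : ℤ} {x : α} (hx : (ρ x : ℤ) = M)
    {s : Finset α} (hs : s ∈ ChP (cX ρ M) n) (hxs : x ∈ s) {a : α} (ha : a ∈ s) (hne : a ≠ x) :
    a < x := by
  rcases hs.2.1 ha hxs hne with h | h
  · exact lt_of_le_of_ne h hne
  · have h1 := hρ (lt_of_le_of_ne h (Ne.symm hne))
    have h2 : (ρ a : ℤ) ≤ M := hs.1 ha
    omega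

theorem Rm_top_mem {ρ : α → ℕ} (hρ : StrictMono ρ) {M n : ℤ} {x : α} (hx : (ρ x : ℤ) = M)
    {f : FF α} (hf : f ∈ Ch (cX ρ M) n) : Rm x f ∈ Ch {a | a < x} (n - 1) := by
  refine supp_mem (fun s hs => ?_) hf
  rw [Rm_single]
  split_ifs with h
  · refine Submodule.smul_mem _ _ (single_mem
      ⟨fun a ha => ?_, (erase_spec α hs.1 hs.2.1 hs.2.2 h).2⟩)
    have ha := Finset.mem_erase.mp (Finset.mem_coe.mp ha)
    exact top_lt hρ hx hs h ha.2 ha.1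
  · exact Submodule.zero_mem _

theorem Kx_Rm_top {ρ : α → ℕ} (hρ : StrictMono ρ) {M n : ℤ} {x : α} (hx : (ρ x : ℤ) = M)
    {s : Finset α} (hs : s ∈ ChP (cX ρ M) n) (hxs : x ∈ s) :
    Kx x (Rm x (Finsupp.single s 1)) = Finsupp.single s 1 := by
  rw [Rm_single, if_pos hxs, map_smul, Kx_single, Finset.insert_erase hxs, smul_smul]
  have : chainSgn α s x = (-1) ^ (s.erase x).card := by
    unfold chainSgn
    congr 2
    ext a
    simp only [Finset.mem_filter, Finset.mem_erase]
    exact ⟨fun h => ⟨h.2.ne, h.1⟩, fun h => ⟨h.2, top_lt hρ hx hs hxs h.2 h.1⟩⟩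
  rw [this, ← mul_pow]; simp

theorem sub_top {ρ : α → ℕ} (hρ : StrictMono ρ) {M n : ℤ} {f : FF α}
    (hf : f ∈ Ch (cX ρ M) n) :
    f - ∑ x : {x : α // (ρ x : ℤ) = M}, Kx x.1 (Rm x.1 f) ∈ Ch (cX ρ (M - 1)) n := by
  have := supp_mem (A := LinearMap.id - ∑ x : {x : α // (ρ x : ℤ) = M}, Kx x.1 ∘ₗ Rm x.1)
    (W := Ch (cX ρ (M - 1)) n) (fun s hs => ?_) hf
  · simpa using this
  simp only [LinearMap.sub_apply, LinearMap.id_apply, LinearMap.sum_apply, LinearMap.comp_apply]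
  by_cases h : ∃ x ∈ s, (ρ x : ℤ) = M
  · obtain ⟨x, hxs, hx⟩ := h
    rw [Finset.sum_eq_single (⟨x, hx⟩ : {x : α // (ρ x : ℤ) = M})]
    · rw [Kx_Rm_top hρ hx hs hxs, sub_self]; exact Submodule.zero_mem _
    · rintro ⟨y, hy⟩ - hne
      have hne' : y ≠ x := fun h => hne (Subtype.ext h)
      rw [Rm_single, if_neg, map_zero]
      intro hys
      have : ρ y < ρ x := hρ (top_lt hρ hx hs hxs hys hne')
      omega
    · simp
  · push Not at h
    rw [Finset.sum_eq_zero, sub_zero]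
    · refine single_mem ⟨fun a ha => ?_, hs.2⟩
      have h1 : (ρ a : ℤ) ≤ M := hs.1 ha
      have h2 := h a ha
      show (ρ a : ℤ) ≤ M - 1
      omega
    · rintro ⟨y, hy⟩ -
      rw [Rm_single, if_neg (fun h' => h y h' hy), map_zero]

theorem claim_step {ρ : α → ℕ} (hρ : StrictMono ρ)
    (hac : ∀ (x : α) (k : ℤ), k ≠ (ρ x : ℤ) - 1 → ∀ f ∈ Ch {a | a < x} k, DD f = 0 →
      ∃ g ∈ Ch {a | a < x} (k + 1), DD g = f) (n : ℤ) (m : ℕ) :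
    ∀ c ∈ Ch (cX ρ (n + m)) n, DD c ∈ SX ρ (n - 1) →
      ∃ b ∈ Ch (Set.univ : Set α) (n + 1), c - DD b ∈ Ch (cX ρ n) n := by
  induction m with
  | zero =>
    intro c hc _
    exact ⟨0, Submodule.zero_mem _, by simpa using hc⟩
  | succ m ih =>
    intro c hc hd
    have key : ∀ x : {x : α // (ρ x : ℤ) = n + (m + 1 : ℕ)},
        ∃ g ∈ Ch {a | a < x.1} n, DD g = Rm x.1 c := by
      rintro ⟨x, hx⟩
      have h := hac x (n - 1) (by push_cast at hx; omega) (Rm x c) (Rm_top_mem hρ hx hc) (by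
        have := Rm_DD hc x
        rw [Rm_SX (by push_cast at hx; omega) hd] at this
        exact neg_eq_zero.mp this.symm)
      simpa using h
    choose g hg hg' using key
    set b := ∑ x, Kx x.1 (g x) with hb
    have hbm : b ∈ Ch (Set.univ : Set α) (n + 1) :=
      Submodule.sum_mem _ fun x _ => Kx_mem (hg x) (Set.subset_univ _) (Set.mem_univ _)
    have hDb : DD b = ∑ x, g x - ∑ x : {x : α // (ρ x : ℤ) = n + (m + 1 : ℕ)},
        Kx x.1 (Rm x.1 c) := by
      rw [hb, map_sum, ← Finset.sum_sub_distrib]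
      refine Finset.sum_congr rfl fun x _ => ?_
      rw [DD_Kx (hg x), hg']
    have hle : n + ((m + 1 : ℕ) : ℤ) - 1 = n + m := by push_cast; ring
    have hs : ∑ x, g x ∈ Ch (cX ρ (n + m)) n :=
      Submodule.sum_mem _ fun x _ => Ch_mono
        (lt_sub hρ (by have := x.2; push_cast at this; omega)) _ (hg x)
    have h1 := sub_top hρ hc
    rw [hle] at h1
    have h2 : c + DD b ∈ Ch (cX ρ (n + m)) n := by
      have := Submodule.add_mem _ h1 hs
      rw [hDb]
      convert this using 1
      abel
    obtain ⟨b', hb', h'⟩ := ih (c + DD b) h2 (by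
      rw [map_add, DD_DD hbm, add_zero]; exact hd)
    refine ⟨b' - b, Submodule.sub_mem _ hb' hbm, ?_⟩
    rw [map_sub]
    convert h' using 1
    abel

theorem claim {ρ : α → ℕ} (hρ : StrictMono ρ)
    (hac : ∀ (x : α) (k : ℤ), k ≠ (ρ x : ℤ) - 1 → ∀ f ∈ Ch {a | a < x} k, DD f = 0 →
      ∃ g ∈ Ch {a | a < x} (k + 1), DD g = f) (n : ℤ)
    (c : FF α) (hc : c ∈ Ch (Set.univ : Set α) n) (hd : DD c ∈ SX ρ (n - 1)) :
      ∃ b ∈ Ch (Set.univ : Set α) (n + 1), c - DD b ∈ Ch (cX ρ n) n := by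
  refine claim_step hρ hac n ((∑ a, ρ a) + n.natAbs) c ?_ hd
  refine Ch_mono (fun a _ => ?_) _ hc
  have : ρ a ≤ ∑ a, ρ a := Finset.single_le_sum (fun _ _ => Nat.zero_le _) (Finset.mem_univ a)
  show (ρ a : ℤ) ≤ _
  omega

theorem rank_bd {ρ : α → ℕ} (hρ : StrictMono ρ) {M n : ℤ} (h : M < n)
    {s : Finset α} (hs : s ∈ ChP (cX ρ M) n) : s = ∅ := by
  by_contra hne
  have hinj : Set.InjOn ρ (s : Set α) := by
    intro a ha b hb hab
    by_contra hne'
    rcases hs.2.1 ha hb hne' with h | h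
    · exact absurd hab (hρ (lt_of_le_of_ne h hne')).ne
    · exact absurd hab (hρ (lt_of_le_of_ne h (Ne.symm hne'))).ne'
  obtain ⟨a, ha⟩ := Finset.nonempty_iff_ne_empty.mpr hne
  have ha' : (ρ a : ℤ) ≤ M := hs.1 ha
  have h1 : s.card ≤ (Finset.range (M.toNat + 1)).card := by
    refine Finset.card_le_card_of_injOn ρ (fun b hb => ?_) hinj
    have hb' : (ρ b : ℤ) ≤ M := hs.1 hb
    simp; omega
  rw [Finset.card_range] at h1
  have := hs.2.2
  omega

end Aux

section Alg

theorem castAddEquiv_nat {G H : ℤ → Type*} [∀ n, AddCommGroup (G n)] [∀ n, AddCommGroup (H n)]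
    (Φ : (n : ℤ) → G n →+ H n) {m n : ℤ} (h : m = n) (x : G m) :
    castAddEquiv H h (Φ m x) = Φ n (castAddEquiv G h x) := by
  subst h; rfl

theorem quasi_iso {G H : ℤ → Type*} [∀ n, AddCommGroup (G n)] [∀ n, AddCommGroup (H n)]
    (d : (n : ℤ) → G n →+ G (n - 1)) (e : (n : ℤ) → H n →+ H (n - 1))
    (Φ : (n : ℤ) → G n →+ H n)
    (hc : ∀ n g, Φ (n - 1) (d n g) = e n (Φ n g))
    (hinj : ∀ n, Function.Injective (Φ n))
    (n : ℤ)
    (hs : ∀ c : H n, e n c = 0 → ∃ (g : G n) (b : H (n + 1)),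
      c = Φ n g + castAddEquiv H (show n + 1 - 1 = n by ring) (e (n + 1) b))
    (hee : ∀ b : H (n + 1), e n (castAddEquiv H (show n + 1 - 1 = n by ring) (e (n + 1) b)) = 0)
    (hi : ∀ (g : G n) (b : H (n + 1)),
      Φ n g = castAddEquiv H (show n + 1 - 1 = n by ring) (e (n + 1) b) →
      ∃ g' : G (n + 1), e (n + 1) b = e (n + 1) (Φ (n + 1) g')) :
    Nonempty (gradedHomology G d n ≃+ gradedHomology H e n) := by
  have hk : ∀ g ∈ (d n).ker, Φ n g ∈ (e n).ker := by
    intro g hg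
    rw [AddMonoidHom.mem_ker] at *
    rw [← hc, hg, map_zero]
  let φ : (d n).ker →+ (e n).ker := ((Φ n).comp (d n).ker.subtype).codRestrict _
    (fun g => hk g.1 g.2)
  have hφ : (boundariesOf G d n).addSubgroupOf (d n).ker =
      ((boundariesOf H e n).addSubgroupOf (e n).ker).comap φ := by
    ext ⟨g, hg⟩
    rw [AddSubgroup.mem_comap, AddSubgroup.mem_addSubgroupOf, AddSubgroup.mem_addSubgroupOf]
    show g ∈ boundariesOf G d n ↔ Φ n g ∈ boundariesOf H e n
    constructor
    · rintro ⟨_, ⟨a, rfl⟩, rfl⟩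
      refine ⟨_, ⟨Φ (n + 1) a, rfl⟩, ?_⟩
      rw [← hc]
      exact castAddEquiv_nat Φ _ _
    · rintro ⟨_, ⟨b, rfl⟩, hb⟩
      obtain ⟨g', hg'⟩ := hi g b hb.symm
      refine ⟨_, ⟨g', rfl⟩, ?_⟩
      apply hinj n
      rw [← hb, hg', ← hc]
      exact (castAddEquiv_nat Φ _ _).symm
  let ψ : (d n).ker →+ gradedHomology H e n :=
    (QuotientAddGroup.mk' ((boundariesOf H e n).addSubgroupOf (e n).ker)).comp φ
  have hψ : ψ.ker = (boundariesOf G d n).addSubgroupOf (d n).ker := by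
    rw [hφ]
    refine (AddMonoidHom.comap_ker
      (QuotientAddGroup.mk' ((boundariesOf H e n).addSubgroupOf (e n).ker)) φ).symm.trans ?_
    rw [QuotientAddGroup.ker_mk']
  have hsurj : Function.Surjective ψ := by
    intro q
    obtain ⟨⟨c, hcc⟩, rfl⟩ := QuotientAddGroup.mk'_surjective
      ((boundariesOf H e n).addSubgroupOf (e n).ker) q
    obtain ⟨g, b, hgb⟩ := hs c hcc
    have hg : g ∈ (d n).ker := by
      rw [AddMonoidHom.mem_ker]
      apply hinj
      rw [hc, map_zero]
      have := congrArg (e n) hgb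
      rw [map_add, hee, add_zero, (AddMonoidHom.mem_ker).mp hcc] at this
      exact this.symm
    refine ⟨⟨g, hg⟩, ?_⟩
    refine (QuotientAddGroup.mk'_eq_mk' _).mpr ?_
    refine ⟨⟨c - Φ n g, sub_mem hcc (hk g hg)⟩, ?_, ?_⟩
    · rw [AddSubgroup.mem_addSubgroupOf]
      refine ⟨_, ⟨b, rfl⟩, ?_⟩
      show _ = c - Φ n g
      rw [hgb, add_sub_cancel_left]; rfl
    · apply Subtype.ext
      show Φ n g + (c - Φ n g) = c
      abel
  exact ⟨(QuotientAddGroup.quotientAddEquivOfEq hψ.symm).trans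
    (QuotientAddGroup.quotientKerEquivOfSurjective ψ hsurj)⟩

theorem lift_inj {A B C : Type*} [AddCommGroup A] [AddCommGroup B] [AddCommGroup C]
    (Ψ : A →+ B) (θ : C →+ B) (hΨ : Function.Injective Ψ) (h : ∀ c, ∃ a, Ψ a = θ c) :
    ∃ d : C →+ A, ∀ c, Ψ (d c) = θ c := by
  choose d hd using h
  refine ⟨AddMonoidHom.mk' d fun a b => hΨ ?_, hd⟩
  rw [map_add, hd, hd, hd, map_add]

end Alg

section Emb

variable {α : Type u} [PartialOrder α]

noncomputable def embR (S : Set α) (n : ℤ) : RCgrp α S n →ₗ[ℤ] FF α :=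
  Finsupp.lmapDomain ℤ ℤ (fun s : RChains α S n => s.1)

noncomputable def embF (n : ℤ) : FCgrp α Set.univ ∅ n →ₗ[ℤ] FF α :=
  Finsupp.lmapDomain ℤ ℤ (fun s : FChains α Set.univ ∅ n => s.1)

theorem embR_single {S : Set α} {n : ℤ} (s : RChains α S n) (a : ℤ) :
    embR S n (Finsupp.single s a) = Finsupp.single s.1 a := Finsupp.mapDomain_single

theorem embF_single {n : ℤ} (s : FChains α Set.univ ∅ n) (a : ℤ) :
    embF n (Finsupp.single s a) = Finsupp.single s.1 a := Finsupp.mapDomain_single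

theorem embR_inj (S : Set α) (n : ℤ) : Function.Injective (embR S n) :=
  Finsupp.mapDomain_injective Subtype.val_injective

theorem embF_inj (n : ℤ) : Function.Injective (embF (α := α) n) :=
  Finsupp.mapDomain_injective Subtype.val_injective

theorem embR_mem {S : Set α} {n : ℤ} (σ : RCgrp α S n) : embR S n σ ∈ Ch S n := by
  induction σ using Finsupp.induction_linear with
  | zero => rw [map_zero]; exact Submodule.zero_mem _
  | add f g hf hg => rw [map_add]; exact Submodule.add_mem _ hf hg
  | single s a => rw [embR_single]; exact Finsupp.single_mem_supported ℤ _ s.2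

theorem embR_surj {S : Set α} {n : ℤ} {f : FF α} (hf : f ∈ Ch S n) : ∃ σ, embR S n σ = f := by
  refine supp_mem (A := LinearMap.id) (W := LinearMap.range (embR S n)) (fun s hs => ?_) hf
  exact ⟨Finsupp.single ⟨s, hs⟩ 1, embR_single _ _⟩

/-- nonempty chains -/
def ChE (n : ℤ) : Set (Finset α) := {s | s ∈ ChP Set.univ n ∧ s ≠ ∅}

theorem ChE_le (n : ℤ) : Finsupp.supported ℤ ℤ (ChE (α := α) n) ≤ Ch Set.univ n :=
  Finsupp.supported_mono fun _ h => h.1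

theorem embF_mem {n : ℤ} (σ : FCgrp α Set.univ ∅ n) :
    embF n σ ∈ Finsupp.supported ℤ ℤ (ChE n) := by
  induction σ using Finsupp.induction_linear with
  | zero => rw [map_zero]; exact Submodule.zero_mem _
  | add f g hf hg => rw [map_add]; exact Submodule.add_mem _ hf hg
  | single s a =>
    rw [embF_single]
    refine Finsupp.single_mem_supported ℤ _ ⟨⟨s.2.1, s.2.2.1, s.2.2.2.1⟩, fun h => ?_⟩
    exact s.2.2.2.2 (by rw [h]; simp)

theorem embF_surj {n : ℤ} {f : FF α} (hf : f ∈ Finsupp.supported ℤ ℤ (ChE n)) :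
    ∃ σ, embF n σ = f := by
  refine supp_mem (A := LinearMap.id) (W := LinearMap.range (embF n)) (fun s hs => ?_) hf
  refine ⟨Finsupp.single ⟨s, hs.1.1, hs.1.2.1, hs.1.2.2, fun h => hs.2 ?_⟩ 1, embF_single _ _⟩
  simpa using h

variable [Fintype α]

theorem DD_single (s : Finset α) : DD (Finsupp.single s (1 : ℤ)) =
    ∑ v ∈ s, chainSgn α s v • Finsupp.single (s.erase v) (1 : ℤ) := by
  rw [DD_apply]
  simp_rw [Rm_single]
  rw [← Finset.sum_filter]
  congr 1
  ext; simp

theorem hom_ext_single {ι M : Type*} [AddCommGroup M] {A B : (ι →₀ ℤ) →+ M}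
    (h : ∀ s, A (Finsupp.single s 1) = B (Finsupp.single s 1)) : A = B := by
  refine Finsupp.addHom_ext' fun s => ?_
  ext
  exact h s

theorem lift_single1 {ι M : Type*} [AddCommGroup M] (g : ι → M) (i : ι) :
    ((Finsupp.lift M ℤ ι) g).toAddMonoidHom (Finsupp.single i 1) = g i := by
  simp [Finsupp.lift_apply]

theorem embR_rd {S : Set α} {n : ℤ} (σ : RCgrp α S n) :
    embR S (n - 1) (rd α S n σ) = DD (embR S n σ) := by
  refine DFunLike.congr_fun (hom_ext_single
    (A := (embR S (n - 1)).toAddMonoidHom.comp (rd α S n))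
    (B := DD.toAddMonoidHom.comp (embR S n).toAddMonoidHom) fun s => ?_) σ
  show embR S (n - 1) (rd α S n _) = DD (embR S n _)
  rw [embR_single, DD_single]
  refine (congrArg (embR S (n - 1)) (lift_single1 _ _)).trans ?_
  refine (map_sum (embR S (n - 1)) _ _).trans ?_
  refine Eq.trans (Finset.sum_congr rfl fun v _ => (map_zsmul (embR S (n - 1)) _ _).trans
    (congrArg _ (embR_single _ _))) ?_
  exact Finset.sum_attach s.1 (fun v => chainSgn α s.1 v • Finsupp.single (s.1.erase v) (1 : ℤ))

noncomputable def Er : FF α →ₗ[ℤ] FF α :=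
  Finsupp.lift (FF α) ℤ (Finset α) (fun s => if s = ∅ then 0 else Finsupp.single s (1 : ℤ))

theorem Er_single (s : Finset α) : Er (Finsupp.single s (1 : ℤ)) =
    if s = ∅ then 0 else Finsupp.single s (1 : ℤ) := by
  simp only [Er, Finsupp.lift_apply, Finsupp.sum_single_index, zero_smul, one_smul]

noncomputable def DE : FF α →ₗ[ℤ] FF α := Er ∘ₗ DD

theorem embF_fd {n : ℤ} (σ : FCgrp α Set.univ ∅ n) :
    embF (n - 1) (fd α Set.univ ∅ n σ) = DE (embF n σ) := by
  refine DFunLike.congr_fun (hom_ext_single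
    (A := (embF (n - 1)).toAddMonoidHom.comp (fd α Set.univ ∅ n))
    (B := DE.toAddMonoidHom.comp (embF n).toAddMonoidHom) fun s => ?_) σ
  show embF (n - 1) (fd α Set.univ ∅ n _) = Er (DD (embF n _))
  rw [embF_single, DD_single]
  refine (congrArg (embF (n - 1)) (lift_single1 _ _)).trans ?_
  refine (map_sum (embF (n - 1)) _ _).trans ?_
  refine Eq.trans ?_ (map_sum Er _ _).symm
  refine Eq.trans ?_ (Finset.sum_attach s.1
    (fun v => Er (chainSgn α s.1 v • Finsupp.single (s.1.erase v) (1 : ℤ))))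
  refine Finset.sum_congr rfl fun v _ => ?_
  refine (map_zsmul (embF (n - 1)) _ _).trans (Eq.trans ?_ (map_zsmul Er _ _).symm)
  refine congrArg _ ?_
  refine Eq.trans ?_ (Er_single _).symm
  by_cases h : s.1.erase v.1 = ∅
  · refine Eq.trans (congrArg _ (dif_neg ?_)) ((map_zero _).trans (if_pos h).symm)
    intro h'; apply h'; rw [h]; simp
  · refine Eq.trans (congrArg _ (dif_pos ?_)) ((embF_single _ _).trans (if_neg h).symm)
    intro h'; apply h
    exact Finset.coe_eq_empty.mp (Set.subset_empty_iff.mp h')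

theorem Er_ne {S : Set α} {n : ℤ} (hn : n ≠ -1) {f : FF α} (hf : f ∈ Ch S n) : Er f = f := by
  refine supp_eq (B := LinearMap.id) (fun s hs => ?_) hf
  rw [Er_single, if_neg]; rfl
  rintro rfl
  have := hs.2.2
  simp at this; omega

theorem Er_eq {S : Set α} {f : FF α} (hf : f ∈ Ch S (-1)) : Er f = 0 := by
  refine supp_eq (B := 0) (fun s hs => ?_) hf
  rw [Er_single, if_pos]; rfl
  have := hs.2.2
  simpa using this

theorem DE_ne {S : Set α} {n : ℤ} (hn : n ≠ 0) {f : FF α} (hf : f ∈ Ch S n) : DE f = DD f :=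
  Er_ne (by omega) (DD_mem hf)

theorem DE_eq {S : Set α} {f : FF α} (hf : f ∈ Ch S 0) : DE f = 0 :=
  Er_eq (DD_mem hf)

theorem DE_mem {S : Set α} {n : ℤ} {f : FF α} (hf : f ∈ Ch S n) : DE f ∈ Ch S (n - 1) := by
  by_cases hn : n = 0
  · subst hn; rw [DE_eq hf]; exact Submodule.zero_mem _
  · rw [DE_ne hn hf]; exact DD_mem hf

theorem DE_DE {S : Set α} {n : ℤ} {f : FF α} (hf : f ∈ Ch S n) : DE (DE f) = 0 := by
  by_cases hn : n = 0
  · subst hn; rw [DE_eq hf, map_zero]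
  · rw [DE_ne hn hf]
    show Er (DD (DD f)) = 0
    rw [DD_DD hf, map_zero]

theorem embR_RCmap {S T : Set α} (h : S ⊆ T) (n : ℤ) (σ : RCgrp α S n) :
    embR T n (RCmap α h n σ) = embR S n σ := by
  refine DFunLike.congr_fun (hom_ext_single
    (A := (embR T n).toAddMonoidHom.comp (RCmap α h n))
    (B := (embR S n).toAddMonoidHom) fun s => ?_) σ
  show embR T n (RCmap α h n _) = embR S n _
  exact (congrArg (embR T n) Finsupp.mapDomain_single).trans
    ((embR_single _ _).trans (embR_single s 1).symm)

theorem embR_removePt (S : Set α) (y : α) (n : ℤ) (σ : RCgrp α S n) :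
    embR Set.univ (n - 1) (removePt α S y n σ) = Rm y (embR S n σ) := by
  refine DFunLike.congr_fun (hom_ext_single
    (A := (embR Set.univ (n - 1)).toAddMonoidHom.comp (removePt α S y n))
    (B := (Rm y).toAddMonoidHom.comp (embR S n).toAddMonoidHom) fun s => ?_) σ
  show embR Set.univ (n - 1) (removePt α S y n _) = Rm y (embR S n _)
  rw [embR_single, Rm_single]
  refine (congrArg (embR Set.univ (n - 1)) (lift_single1 _ _)).trans ?_
  by_cases h : y ∈ s.1
  · refine Eq.trans (congrArg _ (dif_pos h)) (Eq.trans ?_ (if_pos h).symm)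
    exact (map_zsmul (embR Set.univ (n - 1)) _ _).trans (congrArg _ (embR_single _ _))
  · exact Eq.trans (congrArg _ (dif_neg h)) (Eq.trans (map_zero _) (if_neg h).symm)

theorem embR_cast {S : Set α} {m n : ℤ} (h : m = n) (σ : RCgrp α S m) :
    embR S n (castAddEquiv (RCgrp α S) h σ) = embR S m σ := by
  subst h; rfl

theorem embF_cast {m n : ℤ} (h : m = n) (σ : FCgrp α Set.univ ∅ m) :
    embF n (castAddEquiv (FCgrp α Set.univ ∅) h σ) = embF m σ := by
  subst h; rfl

theorem RH_acyclic {S : Set α} {k : ℤ} (h : Subsingleton (RH α S k)) (f : FF α)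
    (hf : f ∈ Ch S k) (hd : DD f = 0) : ∃ g ∈ Ch S (k + 1), DD g = f := by
  obtain ⟨σ, rfl⟩ := embR_surj hf
  have hσ : σ ∈ (rd α S k).ker := by
    rw [AddMonoidHom.mem_ker]
    apply embR_inj
    rw [embR_rd, hd, map_zero]
  have h0 : RH.mk α σ hσ = 0 := Subsingleton.elim _ _
  have h1 := (QuotientAddGroup.eq_zero_iff (⟨σ, hσ⟩ : (rd α S k).ker)).mp h0
  rw [AddSubgroup.mem_addSubgroupOf] at h1
  obtain ⟨_, ⟨b, rfl⟩, hb⟩ := h1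
  refine ⟨embR S (k + 1) b, embR_mem _, ?_⟩
  rw [← embR_rd]
  have hb' : castAddEquiv (RCgrp α S) (show k + 1 - 1 = k by ring) (rd α S (k + 1) b) = σ := hb
  rw [← hb', embR_cast]

/-- the cycle representing a class, if there are no boundaries -/
theorem exists_rep (S : Set α) (k : ℤ) (hS : IsEmpty (RChains α S (k + 1))) :
    ∃ r : RH α S k →+ FF α, Function.Injective r ∧
      ∀ σ hσ, r (RH.mk α σ hσ) = embR S k σ := by
  let ψ : (rd α S k).ker →+ FF α := (embR S k).toAddMonoidHom.comp (rd α S k).ker.subtype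
  have hψ : Function.Injective ψ := fun a b h => Subtype.ext (embR_inj S k h)
  have hb : ∀ a ∈ ((boundariesOf (RCgrp α S) (rd α S) k).addSubgroupOf (rd α S k).ker),
      a = 0 := by
    rintro ⟨a, ha⟩ h
    rw [AddSubgroup.mem_addSubgroupOf] at h
    obtain ⟨_, ⟨b, rfl⟩, hb⟩ := h
    have : b = 0 := Subsingleton.elim _ _
    apply Subtype.ext
    show a = 0
    subst this
    rw [map_zero, map_zero] at hb
    exact hb.symm
  refine ⟨QuotientAddGroup.lift _ ψ (fun a ha => by rw [hb a ha]; exact zero_mem _), ?_, fun σ hσ => rfl⟩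
  refine (injective_iff_map_eq_zero _).mpr fun q => ?_
  obtain ⟨a, rfl⟩ := QuotientAddGroup.mk'_surjective _ q
  intro h
  have : ψ a = 0 := h
  rw [(map_eq_zero_iff ψ hψ).mp this]; exact map_zero _

theorem RH_ind {S : Set α} {k : ℤ} (q : RH α S k) : ∃ σ hσ, q = RH.mk α σ hσ := by
  obtain ⟨⟨σ, hσ⟩, rfl⟩ := QuotientAddGroup.mk'_surjective
    ((boundariesOf (RCgrp α S) (rd α S) k).addSubgroupOf (rd α S k).ker) q
  exact ⟨σ, hσ, rfl⟩

end Emb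

section Main

variable {α : Type u} [PartialOrder α] [Fintype α]

abbrev Fam (ρ : α → ℕ) (n : ℤ) : Type u :=
  Π₀ x : {x : α // (ρ x : ℤ) = n}, RH α {a | a < (x : α)} (n - 1)

theorem Ch_ChE {S : Set α} {n : ℤ} (hn : n ≠ -1) {f : FF α} (hf : f ∈ Ch S n) :
    f ∈ Finsupp.supported ℤ ℤ (ChE n) := by
  have h : ChP S n ⊆ ChE n := by
    intro s hs
    refine ⟨⟨Set.subset_univ _, hs.2⟩, ?_⟩
    rintro rfl
    have := hs.2.2
    simp at this; omega
  exact Finsupp.supported_mono h hf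

theorem ChE_neg {n : ℤ} (hn : n < 0) {f : FF α} (hf : f ∈ Finsupp.supported ℤ ℤ (ChE n)) :
    f = 0 := by
  refine supp_eq (A := LinearMap.id) (B := 0) (fun s hs => ?_) hf
  exfalso
  apply hs.2
  have := hs.1.2.2
  rw [← Finset.card_eq_zero]; omega

theorem DE_ChE {S : Set α} {n : ℤ} {f : FF α} (hf : f ∈ Ch S n) :
    DE f ∈ Finsupp.supported ℤ ℤ (ChE (n - 1)) := by
  by_cases hn : n = 0
  · subst hn; rw [DE_eq hf]; exact Submodule.zero_mem _
  · exact Ch_ChE (by omega) (DE_mem hf)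

structure EE (ρ : α → ℕ) (n : ℤ) (f : FF α) : Prop where
  ch : f ∈ Ch (cX ρ n) n
  dd : DD f ∈ SX ρ (n - 1)
  ne : f ∈ Finsupp.supported ℤ ℤ (ChE n)

theorem EE_DE {ρ : α → ℕ} {n : ℤ} {f : FF α} (h : EE ρ n f) : EE ρ (n - 1) (DE f) := by
  by_cases hn : n = 0
  · subst hn; rw [DE_eq h.ch]
    exact ⟨Submodule.zero_mem _, by rw [map_zero]; exact Submodule.zero_mem _,
      Submodule.zero_mem _⟩
  · refine ⟨?_, ?_, DE_ChE h.ch⟩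
    · rw [DE_ne hn h.ch]
      exact Ch_of_SX (DD_mem h.ch) h.dd
    · rw [DE_ne hn h.ch, DD_DD h.ch]
      exact Submodule.zero_mem _

theorem exists_Psi {ρ : α → ℕ} (hρ : StrictMono ρ) :
    ∃ (r : (n : ℤ) → (x : {x : α // (ρ x : ℤ) = n}) → RH α {a | a < (x : α)} (n - 1) →+ FF α)
      (Ψ : (n : ℤ) → Fam ρ n →+ FF α),
      (∀ n x, Function.Injective (r n x)) ∧
      (∀ n x σ hσ, r n x (RH.mk α σ hσ) = embR _ _ σ) ∧
      (∀ n g (y : {x : α // (ρ x : ℤ) = n}), Rm y.1 (Ψ n g) = r n y (g y)) ∧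
      (∀ n, Function.Injective (Ψ n)) ∧
      (∀ n g, EE ρ n (Ψ n g)) ∧
      (∀ n f, EE ρ n f → ∃ g, Ψ n g = f) ∧
      (∀ n x q, DD (Ψ n (DFinsupp.single x q)) = r n x q) := by
  have hE : ∀ (n : ℤ) (x : {x : α // (ρ x : ℤ) = n}),
      IsEmpty (RChains α {a | a < (x : α)} (n - 1 + 1)) := by
    rintro n ⟨x, hx⟩
    refine ⟨fun s => ?_⟩
    have h1 : s.1 ∈ ChP (cX ρ (n - 1)) (n - 1 + 1) :=
      ⟨s.2.1.trans (lt_sub hρ (x := x) (by omega)), s.2.2⟩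
    have h2 := rank_bd hρ (by omega) h1
    have h3 := h1.2.2
    rw [h2, Finset.card_empty] at h3
    push_cast at h3
    omega
  choose r hr1 hr2 using fun (n : ℤ) (x : {x : α // (ρ x : ℤ) = n}) =>
    exists_rep {a | a < (x : α)} (n - 1) (hE n x)
  have hrm : ∀ n x q, r n x q ∈ Ch {a | a < x.1} (n - 1) := by
    intro n x q
    obtain ⟨σ, hσ, rfl⟩ := RH_ind q
    rw [hr2]; exact embR_mem _
  have hrd : ∀ n x q, DD (r n x q) = 0 := by
    intro n x q
    obtain ⟨σ, hσ, rfl⟩ := RH_ind q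
    rw [hr2, ← embR_rd, AddMonoidHom.mem_ker.mp hσ, map_zero]
  have hrs : ∀ n x, ∀ f ∈ Ch {a | a < x.1} (n - 1), DD f = 0 → ∃ q, r n x q = f := by
    intro n x f hf hd
    obtain ⟨σ, rfl⟩ := embR_surj hf
    refine ⟨RH.mk α σ ?_, hr2 _ _ _ _⟩
    rw [AddMonoidHom.mem_ker]
    apply embR_inj
    rw [embR_rd, hd, map_zero]
  let Ψ : (n : ℤ) → Fam ρ n →+ FF α := fun n =>
    ∑ x : {x : α // (ρ x : ℤ) = n}, (Kx x.1).toAddMonoidHom.comp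
      ((r n x).comp (DFinsupp.evalAddMonoidHom x))
  have hΨ : ∀ n g, Ψ n g = ∑ x : {x : α // (ρ x : ℤ) = n}, Kx x.1 (r n x (g x)) := by
    intro n g
    simp only [Ψ, AddMonoidHom.finsetSum_apply]
    rfl
  have hRm : ∀ n g (y : {x : α // (ρ x : ℤ) = n}), Rm y.1 (Ψ n g) = r n y (g y) := by
    intro n g y
    rw [hΨ, map_sum, Finset.sum_eq_single y]
    · exact Rm_Kx_self (hrm _ _ _)
    · intro x _ hxy
      rw [Rm_Kx_ne (fun h => hxy (Subtype.ext h.symm)) (hrm _ _ _),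
        Rm_of_notMem ?_ (hrm _ _ _), map_zero, neg_zero]
      intro h
      have h1 : ρ y.1 < ρ x.1 := hρ h
      have := x.2
      have := y.2
      omega
    · simp
  have hDD : ∀ n g, DD (Ψ n g) = ∑ x : {x : α // (ρ x : ℤ) = n}, r n x (g x) := by
    intro n g
    rw [hΨ, map_sum]
    refine Finset.sum_congr rfl fun x _ => ?_
    rw [DD_Kx (hrm _ _ _), hrd, map_zero, sub_zero]
  refine ⟨r, Ψ, hr1, hr2, hRm, ?_, ?_, ?_, ?_⟩
  · intro n g h hgh
    ext y
    apply hr1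
    rw [← hRm, ← hRm, hgh]
  · intro n g
    have hch : Ψ n g ∈ Ch (cX ρ n) n := by
      rw [hΨ]
      refine Submodule.sum_mem _ fun x _ => ?_
      have := Kx_mem (hrm n x (g x)) (T := cX ρ n)
        (lt_sub hρ (by have := x.2; omega)) (le_of_eq x.2)
      rwa [sub_add_cancel] at this
    refine ⟨hch, ?_, ?_⟩
    · rw [hDD]
      exact Submodule.sum_mem _ fun x _ => Ch_le_SX
        (Ch_mono (lt_sub hρ (by have := x.2; omega)) _ (hrm n x (g x)))
    · by_cases hn : n = -1
      · rw [hΨ, Finset.sum_eq_zero]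
        · exact Submodule.zero_mem _
        · intro x _
          have := x.2
          omega
      · exact Ch_ChE hn hch
  · intro n f hf
    have key : ∀ x : {x : α // (ρ x : ℤ) = n}, ∃ q, r n x q = Rm x.1 f := by
      intro x
      refine hrs n x _ (Rm_top_mem hρ x.2 hf.ch) ?_
      have := Rm_DD hf.ch x.1
      rw [Rm_SX (by have := x.2; omega) hf.dd] at this
      exact neg_eq_zero.mp this.symm
    choose q hq using key
    refine ⟨DFinsupp.equivFunOnFintype.symm q, ?_⟩
    rw [hΨ]
    have h1 := sub_top hρ hf.ch
    have h2 : f - ∑ x : {x : α // (ρ x : ℤ) = n}, Kx x.1 (Rm x.1 f) = 0 := by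
      by_cases hn : n < 0
      · have hf0 := ChE_neg hn hf.ne
        simp [hf0]
      · refine supp_eq (A := LinearMap.id) (B := 0) (fun s hs => ?_) h1
        exfalso
        have h3 := rank_bd hρ (by omega) hs
        have h4 := hs.2.2
        rw [h3, Finset.card_empty] at h4
        push_cast at h4
        omega
    rw [sub_eq_zero] at h2
    conv_rhs => rw [h2]
    refine Finset.sum_congr rfl fun x _ => ?_
    rw [← hq]; rfl
  · intro n x q
    rw [hDD, Finset.sum_eq_single x]
    · rw [DFinsupp.single_eq_same]
    · intro y _ hy
      rw [DFinsupp.single_eq_of_ne hy, map_zero]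
    · simp

theorem qc_strict {ρ : α → ℕ} (h : IsQuasicellular α ρ) : StrictMono ρ := by
  intro a b hab
  refine lt_of_le_of_ne (h.1 hab.le) fun he => ?_
  exact h.2.1 (ρ b) (show ρ a = ρ b from he) (show ρ b = ρ b from rfl) hab.ne hab.le

end Main

/-- Let `X` be a finite quasicellular poset with quasicellular morphism `ρ`.  Then there is a
chain complex with `C_n = ⊕_{ρ(x) = n} H̃^f_{n-1}(Û_x)` whose differentials are given by the
formula `[∑ aᵢ sᵢ] ↦ ([∑_{sᵢ ∋ y} aᵢ sgn_{sᵢ}(y) (sᵢ ∖ {y})])_y` and whose homology is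
isomorphic to `H^f_*(X)`. -/
theorem stmt6 {α : Type u} [PartialOrder α] [Fintype α] (ρ : α → ℕ)
    (hρ : IsQuasicellular α ρ) :
    ∃ d : (n : ℤ) →
        ((Π₀ x : {x : α // (ρ x : ℤ) = n}, RH α {a | a < (x : α)} (n - 1)) →+
          Π₀ x : {x : α // (ρ x : ℤ) = n - 1}, RH α {a | a < (x : α)} (n - 1 - 1)),
      (∀ n : ℤ, (d (n - 1)).comp (d n) = 0) ∧
      (∀ (n : ℤ) (x : {x : α // (ρ x : ℤ) = n})
          (σ : RCgrp α {a | a < (x : α)} (n - 1))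
          (hσ : σ ∈ (rd α {a | a < (x : α)} (n - 1)).ker)
          (y : {y : α // (ρ y : ℤ) = n - 1}),
        ∃ (w : RCgrp α {a | a < (y : α)} (n - 1 - 1))
            (hw : w ∈ (rd α {a | a < (y : α)} (n - 1 - 1)).ker),
          RCmap α (Set.subset_univ {a | a < (y : α)}) (n - 1 - 1) w =
              removePt α {a | a < (x : α)} (y : α) (n - 1) σ ∧
            d n (DFinsupp.single x (RH.mk α σ hσ)) y = RH.mk α w hw) ∧
      (∀ n : ℤ, Nonempty
        (gradedHomology
          (fun n => Π₀ x : {x : α // (ρ x : ℤ) = n}, RH α {a | a < (x : α)} (n - 1))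
          d n ≃+ HF α Set.univ n)) := by

  have hs := qc_strict hρ
  have hac : ∀ (x : α) (k : ℤ), k ≠ (ρ x : ℤ) - 1 → ∀ f ∈ Ch {a | a < x} k, DD f = 0 →
      ∃ g ∈ Ch {a | a < x} (k + 1), DD g = f := fun x k hk f hf hd =>
    RH_acyclic ((hρ.2.2 x).1 k hk) f hf hd
  obtain ⟨r, Ψ, hr1, hr2, hRm, hinj, hEE, hsurj, hDs⟩ := exists_Psi hs
  have hd : ∀ n : ℤ, ∃ d : Fam ρ n →+ Fam ρ (n - 1), ∀ g, Ψ (n - 1) (d g) = DE (Ψ n g) :=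
    fun n => lift_inj (Ψ (n - 1)) (DE.toAddMonoidHom.comp (Ψ n)) (hinj _)
      fun g => hsurj _ _ (EE_DE (hEE n g))
  have hΦ : ∀ n : ℤ, ∃ d : Fam ρ n →+ FCgrp α Set.univ ∅ n, ∀ g, embF n (d g) = Ψ n g :=
    fun n => lift_inj (embF n).toAddMonoidHom (Ψ n) (embF_inj n)
      fun g => embF_surj (hEE n g).ne
  choose d hd using hd
  choose Φ hΦ using hΦ
  refine ⟨d, ?_, ?_, ?_⟩
  · intro n
    refine AddMonoidHom.ext fun g => ?_
    apply hinj
    show Ψ (n - 1 - 1) (d (n - 1) (d n g)) = Ψ (n - 1 - 1) 0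
    rw [hd, hd, DE_DE (hEE n g).ch, map_zero]
  · intro n x σ hσ y
    have hy := y.2
    have hF := embR_mem σ
    have hF' := Ch_mono (lt_sub hs (M := n - 1) (by have := x.2; omega)) _ hF
    have hD : DD (embR _ _ σ) = 0 := by
      rw [← embR_rd, AddMonoidHom.mem_ker.mp hσ, map_zero]
    obtain ⟨w, hw⟩ := embR_surj (Rm_top_mem hs hy hF')
    have hwk : w ∈ (rd α {a | a < (y : α)} (n - 1 - 1)).ker := by
      rw [AddMonoidHom.mem_ker]
      apply embR_inj
      have := Rm_DD hF y.1
      rw [hD, map_zero] at this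
      rw [embR_rd, hw, map_zero]
      exact neg_eq_zero.mp this.symm
    refine ⟨w, hwk, ?_, ?_⟩
    · apply embR_inj
      rw [embR_RCmap, embR_removePt, hw]
    · apply hr1
      rw [← hRm, hd, DE_ne (by omega) (hEE n _).ch, hDs, hr2, hr2, hw]
  · intro n
    show Nonempty (_ ≃+ gradedHomology (FCgrp α Set.univ ∅) (fd α Set.univ ∅) n)
    refine quasi_iso (G := Fam ρ) (H := FCgrp α Set.univ ∅) d (fd α Set.univ ∅) Φ ?_ ?_ n ?_ ?_ ?_
    · intro n g
      apply embF_inj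
      rw [hΦ, hd, embF_fd, hΦ]
    · intro n g h hgh
      apply hinj
      rw [← hΦ, ← hΦ, hgh]
    · intro c hc
      have hcm := embF_mem c
      have hcm' := ChE_le n hcm
      by_cases hn : n < 0
      · refine ⟨0, 0, ?_⟩
        apply embF_inj
        rw [ChE_neg hn hcm, map_zero, map_zero, map_zero, add_zero, map_zero]
      have hDE : DE (embF n c) = 0 := by rw [← embF_fd, hc, map_zero]
      have hDD : DD (embF n c) ∈ SX ρ (n - 1) := by
        by_cases h0 : n = 0
        · subst h0
          refine Finsupp.supported_mono (fun s hs => ?_) (DD_mem hcm')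
          have h1 : s = ∅ := by simpa using hs.2.2
          subst h1
          show ((∅ : Finset α) : Set α) ⊆ _
          simp
        · rw [← DE_ne h0 hcm', hDE]; exact Submodule.zero_mem _
      obtain ⟨b, hb, hb'⟩ := claim hs hac n _ hcm' hDD
      obtain ⟨b, rfl⟩ := embF_surj (Ch_ChE (by omega) hb)
      obtain ⟨g, hg⟩ := hsurj n (embF n c - DD (embF (n + 1) b))
        ⟨hb', by rw [map_sub, DD_DD hb, sub_zero]; exact hDD, Ch_ChE (by omega) hb'⟩
      refine ⟨g, b, ?_⟩
      apply embF_inj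
      rw [map_add, embF_cast, embF_fd, hΦ, hg, DE_ne (by omega) hb, sub_add_cancel]
    · intro b
      apply embF_inj
      rw [embF_fd, embF_cast, embF_fd, DE_DE (ChE_le _ (embF_mem b)), map_zero]
    · intro g b hgb
      have hbm := embF_mem b
      have hbm' := ChE_le _ hbm
      by_cases hn : n < 0
      · refine ⟨0, ?_⟩
        apply embF_inj
        rw [map_zero, map_zero, embF_fd, map_zero]
        exact ChE_neg (by omega) (DE_ChE hbm')
      have h1 := congrArg (embF n) hgb
      rw [embF_cast, embF_fd, hΦ, DE_ne (by omega) hbm'] at h1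
      have hDD : DD (embF (n + 1) b) ∈ SX ρ (n + 1 - 1) := by
        rw [← h1, add_sub_cancel_right]
        exact Ch_le_SX (hEE n g).ch
      obtain ⟨b2, hb2, hb2'⟩ := claim hs hac (n + 1) _ hbm' hDD
      obtain ⟨g', hg'⟩ := hsurj (n + 1) (embF (n + 1) b - DD b2)
        ⟨hb2', by rw [map_sub, DD_DD hb2, sub_zero]; exact hDD, Ch_ChE (by omega) hb2'⟩
      refine ⟨g', ?_⟩
      apply embF_inj
      rw [embF_fd, embF_fd, hΦ, hg', DE_ne (by omega) hbm', DE_ne (by omega) hb2', map_sub,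
        DD_DD hb2, sub_zero]
end
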